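/- Let T = (V,E) be a tree with n ≥ 3 vertices, maximum degree Δ, and let f(x,y) = √(4x + 4(y−1)) − √(4x + y). If Σ_{v ∈ V'} f(l(v), δ(v)) ≥ 0, then Σ_{v ∈ V'} √(3·l(v) + d(v)) ≤ Σ_{v ∈ V} 2·√(d(v) − 1) + 2·(√Δ − √(Δ − 1)). -/

import Mathlib

open Finset

namespace GraphEnergy

variable {V : Type*} [Fintype V] [DecidableEq V]

/-- The set of inner vertices: vertices of degree at least 2. -/
def innerVerts (G : SimpleGraph V) [DecidableRel G.Adj] : Finset V :=
  univ.filter (fun v => 2 ≤ G.degree v)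

/-- The number of neighbors of `v` that are leaves. -/
def leafCount (G : SimpleGraph V) [DecidableRel G.Adj] (v : V) : ℕ :=
  ((G.neighborFinset v).filter (fun w => G.degree w = 1)).card

/-- The number of neighbors of `v` of degree greater than 1. -/
def innerCount (G : SimpleGraph V) [DecidableRel G.Adj] (v : V) : ℕ :=
  ((G.neighborFinset v).filter (fun w => 1 < G.degree w)).card

/-- The auxiliary function `f(x,y) = √(4x + 4(y-1)) - √(4x + y)`. -/
noncomputable def auxf (x y : ℝ) : ℝ :=
  Real.sqrt (4 * x + 4 * (y - 1)) - Real.sqrt (4 * x + y)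

/-- Every neighbor of `v` is either a leaf or has degree greater than 1. -/
lemma leafCount_add_innerCount (G : SimpleGraph V) [DecidableRel G.Adj] (v : V) :
    leafCount G v + innerCount G v = G.degree v := by
  have h : (G.neighborFinset v).filter (fun w => 1 < G.degree w) =
      (G.neighborFinset v).filter (fun w => ¬ G.degree w = 1) := by
    refine filter_congr fun w hw => ?_
    have hpos : 0 < G.degree w :=
      (G.degree_pos_iff_exists_adj w).2 ⟨v, ((G.mem_neighborFinset v w).1 hw).symm⟩
    omega
  rw [leafCount, innerCount, h, card_filter_add_card_filter_not, G.card_neighborFinset_eq_degree]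

lemma auxf_leafCount_innerCount (G : SimpleGraph V) [DecidableRel G.Adj] (v : V) :
    auxf (leafCount G v : ℝ) (innerCount G v : ℝ) =
      2 * Real.sqrt ((G.degree v : ℝ) - 1) -
        Real.sqrt (3 * (leafCount G v : ℝ) + (G.degree v : ℝ)) := by
  have h4 : Real.sqrt 4 = 2 := by
    rw [show (4 : ℝ) = 2 ^ 2 by norm_num, Real.sqrt_sq zero_le_two]
  rw [auxf, ← leafCount_add_innerCount G v, ← h4, ← Real.sqrt_mul zero_le_four]
  push_cast
  ring_nf

/-- Criterion i): if `∑_{v ∈ V'} f(l(v), δ(v)) ≥ 0` for a tree on `n ≥ 3` vertices, then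
the new bound improves the Arizmendi–Dominguez bound. -/
theorem tree_criterion_i (G : SimpleGraph V) [DecidableRel G.Adj]
    (hT : G.IsTree) (hn : 3 ≤ Fintype.card V)
    (hcond : 0 ≤ ∑ v ∈ innerVerts G, auxf (leafCount G v : ℝ) (innerCount G v : ℝ)) :
    ∑ v ∈ innerVerts G, Real.sqrt (3 * (leafCount G v : ℝ) + (G.degree v : ℝ)) ≤
      (∑ v : V, 2 * Real.sqrt ((G.degree v : ℝ) - 1)) +
        2 * (Real.sqrt (G.maxDegree : ℝ) - Real.sqrt ((G.maxDegree : ℝ) - 1)) := by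
  simp only [auxf_leafCount_innerCount, sum_sub_distrib] at hcond
  have hsum : ∑ v ∈ innerVerts G, 2 * Real.sqrt ((G.degree v : ℝ) - 1) ≤
      ∑ v : V, 2 * Real.sqrt ((G.degree v : ℝ) - 1) :=
    sum_le_sum_of_subset_of_nonneg (subset_univ _) fun _ _ _ => by positivity
  have hmax : Real.sqrt ((G.maxDegree : ℝ) - 1) ≤ Real.sqrt (G.maxDegree : ℝ) :=
    Real.sqrt_le_sqrt (by linarith)
  linarith

end GraphEnergy
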